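/- The set H₂ of all bijections of C of the form g_J for an order-preserving code J all of whose pairs (α, β) satisfy |α| ≡ |β| (mod 2) is a subgroup of Thompson's group F. -/

import Mathlib

open Set MeasureTheory Filter Topology

/-- The binary Cantor space. -/
abbrev CantorC : Type := ℕ → Bool

/-- Finite binary words. -/
abbrev BWord : Type := List Bool

/-- Prepend a finite word to an infinite binary sequence. -/
def wordApp (w : BWord) (x : CantorC) : CantorC := fun n =>
  if h : n < w.length then w.get ⟨n, h⟩ else x (n - w.length)

/-- The cylinder of sequences beginning with the word `w`. -/
def cyl (w : BWord) : Set CantorC := Set.range (wordApp w)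

/-- `J` is a code: both the α-cylinders and the β-cylinders form a partition of the
Cantor space (every point lies in the cylinder of exactly one pair). -/
def IsCode (J : Finset (BWord × BWord)) : Prop :=
  (∀ x : CantorC, ∃! p : BWord × BWord, p ∈ J ∧ x ∈ cyl p.1) ∧
  (∀ x : CantorC, ∃! p : BWord × BWord, p ∈ J ∧ x ∈ cyl p.2)

/-- `J` is order preserving: α ≺ α' lexicographically iff β ≺ β' lexicographically. -/
def OrdPres (J : Finset (BWord × BWord)) : Prop :=
  ∀ p ∈ J, ∀ q ∈ J, (List.Lex (· < ·) p.1 q.1 ↔ List.Lex (· < ·) p.2 q.2)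

/-- The bijection `g` is induced by the code `J` : it maps `β·x` to `α·x`. -/
def InducedBy (J : Finset (BWord × BWord)) (g : Equiv.Perm CantorC) : Prop :=
  ∀ p ∈ J, ∀ x : CantorC, g (wordApp p.2 x) = wordApp p.1 x

/-- `J` is an order-preserving code inducing the bijection `g`. -/
def IsCodeFor (J : Finset (BWord × BWord)) (g : Equiv.Perm CantorC) : Prop :=
  IsCode J ∧ OrdPres J ∧ InducedBy J g

/-- Membership in (the realization on the Cantor space of) Thompson's group `F`. -/
def InF (g : Equiv.Perm CantorC) : Prop := ∃ J, IsCodeFor J g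

/-- The pair `(α, β)` has `|α| ≡ |β| (mod 2)`. -/
def EvenPair (p : BWord × BWord) : Prop := p.1.length % 2 = p.2.length % 2

/-- Membership in the subgroup `H₂` : some order-preserving code for `g` has all
pairs of even length difference. -/
def InH2 (g : Equiv.Perm CantorC) : Prop :=
  ∃ J, IsCodeFor J g ∧ ∀ p ∈ J, EvenPair p

/-- The union of the α-cylinders over pairs of even length difference. -/
def pSet (J : Finset (BWord × BWord)) : Set CantorC :=
  {x | ∃ p ∈ J, EvenPair p ∧ x ∈ cyl p.1}

/-- The union of the β-cylinders over pairs of even length difference. -/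
def eSet (J : Finset (BWord × BWord)) : Set CantorC :=
  {x | ∃ p ∈ J, EvenPair p ∧ x ∈ cyl p.2}

/-- `p_f` : for `f ∈ F` this equals `pSet J` for any (equivalently, every)
order-preserving code `J` for `f`. -/
def pF (g : Equiv.Perm CantorC) : Set CantorC :=
  ⋃ J ∈ {J : Finset (BWord × BWord) | IsCodeFor J g}, pSet J

/-- `E_f` : for `f ∈ F` this equals `eSet J` for any (equivalently, every)
order-preserving code `J` for `f`. -/
def EF (g : Equiv.Perm CantorC) : Set CantorC :=
  ⋃ J ∈ {J : Finset (BWord × BWord) | IsCodeFor J g}, eSet J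

/-- `Ω₂ = {p_f : f ∈ F}`. -/
def Omega2 : Set (Set CantorC) := {p | ∃ g, InF g ∧ pF g = p}

/-- The action `f · p = f(p ∩ E_f) ∪ f((C ∖ p) ∩ (C ∖ E_f))`. -/
def actF (g : Equiv.Perm CantorC) (p : Set CantorC) : Set CantorC :=
  g '' (p ∩ EF g) ∪ g '' (pᶜ ∩ (EF g)ᶜ)

open Classical in
/-- `T(p)` as a Boolean-valued characteristic function: `T(p) w = true` iff the
cylinder of `w` meets `p`. -/
noncomputable def Tb (p : Set CantorC) : BWord → Bool :=
  fun w => if (cyl w ∩ p).Nonempty then true else false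

/-- The embedding `p ↦ (T(p), T(C ∖ p))`. -/
noncomputable def embedT (p : Set CantorC) : (BWord → Bool) × (BWord → Bool) :=
  (Tb p, Tb pᶜ)

/-- `Ω̄₂` : the closure of the image of `Ω₂` under the embedding. -/
noncomputable def OmegaBar : Set ((BWord → Bool) × (BWord → Bool)) :=
  closure (embedT '' Omega2)

theorem wordApp_append (a b : BWord) (x : CantorC) :
    wordApp (a ++ b) x = wordApp a (wordApp b x) := by
  funext n
  simp only [wordApp, List.length_append, List.get_eq_getElem]
  by_cases h₁ : n < a.length
  · have h₂ : n < a.length + b.length := by omega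
    simp [h₁, h₂, List.getElem_append_left]
  · by_cases h₂ : n < a.length + b.length
    · have h₃ : n - a.length < b.length := by omega
      simp [h₁, h₂, h₃, List.getElem_append_right (not_lt.mp h₁)]
    · have h₃ : ¬ n - a.length < b.length := by omega
      simp only [h₁, h₂, h₃, dite_false]
      congr 1
      omega

theorem mem_cyl_iff {a : BWord} {x : CantorC} :
    x ∈ cyl a ↔ ∀ (i : ℕ) (h : i < a.length), x i = a[i] := by
  constructor
  · rintro ⟨y, rfl⟩ i h
    simp [wordApp, h]
  · intro h
    refine ⟨fun n => x (n + a.length), ?_⟩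
    funext n
    by_cases hn : n < a.length
    · simp [wordApp, hn, h n hn]
    · simp [wordApp, hn, Nat.sub_add_cancel (not_lt.mp hn)]

theorem wordApp_mem_cyl (a : BWord) (x : CantorC) : wordApp a x ∈ cyl a := ⟨x, rfl⟩

theorem prefix_of_mem_cyl {a b : BWord} {x : CantorC} (ha : x ∈ cyl a) (hb : x ∈ cyl b)
    (h : a.length ≤ b.length) : a <+: b := by
  rw [List.prefix_iff_getElem]
  refine ⟨h, fun i hi => ?_⟩
  rw [← mem_cyl_iff.mp ha i hi, ← mem_cyl_iff.mp hb i (hi.trans_le h)]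

theorem not_disjoint_cyl_of_prefix {a b : BWord} (h : a <+: b) : ¬ Disjoint (cyl a) (cyl b) := by
  obtain ⟨t, rfl⟩ := h
  refine Set.not_disjoint_iff.mpr ⟨wordApp (a ++ t) fun _ => false, ?_, wordApp_mem_cyl _ _⟩
  rw [wordApp_append]
  exact wordApp_mem_cyl _ _

theorem toLex_wordApp_lt_iff (a : BWord) (x y : CantorC) :
    toLex (wordApp a x) < toLex (wordApp a y) ↔ toLex x < toLex y := by
  constructor
  · rintro ⟨n, h, hn⟩
    simp only [Pi.toLex_apply] at h hn
    by_cases hna : n < a.length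
    · simp [wordApp, hna] at hn
    · refine ⟨n - a.length, fun j hj => ?_, ?_⟩
      · simpa [wordApp] using h (j + a.length) (by omega)
      · simpa [wordApp, hna] using hn
  · rintro ⟨n, h, hn⟩
    simp only [Pi.toLex_apply] at h hn
    refine ⟨n + a.length, fun j hj => ?_, by simpa [wordApp] using hn⟩
    by_cases hja : j < a.length
    · simp [wordApp, hja]
    · simpa [wordApp, hja] using h (j - a.length) (by omega)

theorem toLex_wordApp_lt_of_lex {a b : BWord} (h : List.Lex (· < ·) a b) (hab : ¬ a <+: b)
    (x y : CantorC) : toLex (wordApp a x) < toLex (wordApp b y) := by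
  induction h with
  | nil => exact absurd (List.nil_prefix) hab
  | rel h => exact ⟨0, by simp, by simpa [wordApp] using h⟩
  | @cons c a b h ih =>
    have key := ih fun hp => hab (List.cons_prefix_cons.mpr ⟨rfl, hp⟩)
    change toLex (wordApp ([c] ++ a) x) < toLex (wordApp ([c] ++ b) y)
    rwa [wordApp_append, wordApp_append, toLex_wordApp_lt_iff]

theorem lex_iff_toLex_wordApp_lt {a b : BWord} (hab : Disjoint (cyl a) (cyl b))
    (x y : CantorC) :
    List.Lex (· < ·) a b ↔ toLex (wordApp a x) < toLex (wordApp b y) := by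
  refine ⟨fun h => toLex_wordApp_lt_of_lex h (fun hp => not_disjoint_cyl_of_prefix hp hab) x y,
    fun h => ?_⟩
  rcases lt_trichotomy a b with hlt | rfl | hgt
  · exact hlt
  · exact absurd hab (not_disjoint_cyl_of_prefix List.prefix_rfl)
  · exact absurd h (toLex_wordApp_lt_of_lex hgt
      (fun hp => not_disjoint_cyl_of_prefix hp hab.symm) y x).asymm

/-- `g` is strictly increasing for the lexicographic order on the Cantor space. -/
def LexStrictMono (g : Equiv.Perm CantorC) : Prop :=
  ∀ x y : CantorC, toLex x < toLex y → toLex (g x) < toLex (g y)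

/-- On every cylinder of words of length `N`, the bijection `g` replaces the word by another one
whose length has the same parity. -/
def EvenAtDepth (N : ℕ) (g : Equiv.Perm CantorC) : Prop :=
  ∀ w : BWord, w.length = N → ∃ a : BWord, a.length % 2 = w.length % 2 ∧
    ∀ x : CantorC, g (wordApp w x) = wordApp a x

theorem LexStrictMono.lt_iff_lt {g : Equiv.Perm CantorC} (hg : LexStrictMono g) {x y : CantorC} :
    toLex (g x) < toLex (g y) ↔ toLex x < toLex y := by
  refine ⟨fun h => ?_, hg x y⟩
  rcases lt_trichotomy (toLex x) (toLex y) with hlt | heq | hgt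
  · exact hlt
  · rw [toLex_inj.mp heq] at h
    exact absurd h (lt_irrefl _)
  · exact absurd h (hg y x hgt).asymm

theorem disjoint_cyl_of_existsUnique {ι : Type*} {s : Set ι} {w : ι → BWord}
    (h : ∀ x : CantorC, ∃! p : ι, p ∈ s ∧ x ∈ cyl (w p)) {p q : ι} (hp : p ∈ s) (hq : q ∈ s)
    (hpq : p ≠ q) : Disjoint (cyl (w p)) (cyl (w q)) :=
  Set.disjoint_left.mpr fun x hx hx' => hpq ((h x).unique ⟨hp, hx⟩ ⟨hq, hx'⟩)

theorem IsCode.disjoint_fst {J : Finset (BWord × BWord)} (h : IsCode J) {p q : BWord × BWord}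
    (hp : p ∈ J) (hq : q ∈ J) (hpq : p ≠ q) : Disjoint (cyl p.1) (cyl q.1) :=
  disjoint_cyl_of_existsUnique (s := J) (w := Prod.fst) h.1 hp hq hpq

theorem IsCode.disjoint_snd {J : Finset (BWord × BWord)} (h : IsCode J) {p q : BWord × BWord}
    (hp : p ∈ J) (hq : q ∈ J) (hpq : p ≠ q) : Disjoint (cyl p.2) (cyl q.2) :=
  disjoint_cyl_of_existsUnique (s := J) (w := Prod.snd) h.2 hp hq hpq

theorem IsCodeFor.lexStrictMono {J : Finset (BWord × BWord)} {g : Equiv.Perm CantorC}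
    (h : IsCodeFor J g) : LexStrictMono g := by
  obtain ⟨hJ, hord, hind⟩ := h
  intro x y hxy
  obtain ⟨p, ⟨hp, x, rfl⟩, -⟩ := hJ.2 x
  obtain ⟨q, ⟨hq, y, rfl⟩, -⟩ := hJ.2 y
  rw [hind p hp, hind q hq]
  by_cases hpq : p = q
  · subst hpq
    rwa [toLex_wordApp_lt_iff] at hxy ⊢
  · rwa [← lex_iff_toLex_wordApp_lt (hJ.disjoint_fst hp hq hpq), hord p hp q hq,
      lex_iff_toLex_wordApp_lt (hJ.disjoint_snd hp hq hpq)]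

theorem InducedBy.mem_cyl_iff {J : Finset (BWord × BWord)} {g : Equiv.Perm CantorC}
    (h : InducedBy J g) {p : BWord × BWord} (hp : p ∈ J) (x : CantorC) :
    x ∈ cyl p.1 ↔ g⁻¹ x ∈ cyl p.2 := by
  constructor
  · rintro ⟨y, rfl⟩
    exact ⟨y, by simp [← h p hp]⟩
  · rintro ⟨y, hy⟩
    exact ⟨y, by simp [← h p hp, hy]⟩

theorem IsCodeFor.of_lexStrictMono {J : Finset (BWord × BWord)} {g : Equiv.Perm CantorC}
    (hJ : ∀ x : CantorC, ∃! p : BWord × BWord, p ∈ J ∧ x ∈ cyl p.2) (hind : InducedBy J g)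
    (hg : LexStrictMono g) : IsCodeFor J g := by
  have hcode : IsCode J := by
    refine ⟨fun x => ?_, hJ⟩
    refine (existsUnique_congr fun p => ?_).mpr (hJ (g⁻¹ x))
    exact and_congr_right fun hp => hind.mem_cyl_iff hp x
  refine ⟨hcode, fun p hp q hq => ?_, hind⟩
  by_cases hpq : p = q
  · subst hpq
    exact iff_of_false (lt_irrefl p.1) (lt_irrefl p.2)
  · let x : CantorC := fun _ => false
    rw [lex_iff_toLex_wordApp_lt (hcode.disjoint_fst hp hq hpq) x x,
      lex_iff_toLex_wordApp_lt (hcode.disjoint_snd hp hq hpq) x x, ← hind p hp, ← hind q hq,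
      hg.lt_iff_lt]

theorem IsCodeFor.exists_evenAtDepth {J : Finset (BWord × BWord)} {g : Equiv.Perm CantorC}
    (h : IsCodeFor J g) (heven : ∀ p ∈ J, EvenPair p) : ∃ N, EvenAtDepth N g := by
  refine ⟨J.sup fun p => p.2.length, fun w hw => ?_⟩
  obtain ⟨p, ⟨hp, hmem⟩, -⟩ := h.1.2 (wordApp w fun _ => false)
  have hle : p.2.length ≤ w.length := by
    rw [hw]
    exact Finset.le_sup (f := fun p : BWord × BWord => p.2.length) hp
  obtain ⟨t, rfl⟩ := prefix_of_mem_cyl hmem (wordApp_mem_cyl _ _) hle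
  refine ⟨p.1 ++ t, ?_, fun x => ?_⟩
  · have := heven p hp
    unfold EvenPair at this
    simp only [List.length_append]
    omega
  · rw [wordApp_append, wordApp_append, h.2.2 p hp]

theorem EvenAtDepth.inH2 {N : ℕ} {g : Equiv.Perm CantorC} (h : EvenAtDepth N g)
    (hg : LexStrictMono g) : InH2 g := by
  choose a ha hga using fun v : Fin N → Bool => h (List.ofFn v) List.length_ofFn
  have hmem {p : BWord × BWord} :
      p ∈ Finset.univ.image (fun v : Fin N → Bool => (a v, List.ofFn v)) ↔
        ∃ v, (a v, List.ofFn v) = p := by simp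
  refine ⟨Finset.univ.image fun v : Fin N → Bool => (a v, List.ofFn v),
    IsCodeFor.of_lexStrictMono (fun x => ?_) (fun p hp x => ?_) hg, fun p hp => ?_⟩
  · refine ⟨_, ⟨hmem.mpr ⟨fun i => x i, rfl⟩, mem_cyl_iff.mpr fun i hi => by simp⟩, ?_⟩
    rintro p ⟨hp, hx⟩
    obtain ⟨v, rfl⟩ := hmem.mp hp
    obtain rfl : v = fun i : Fin N => x i := by
      funext i
      simpa using (mem_cyl_iff.mp hx i (by simp)).symm
    rfl
  · obtain ⟨v, rfl⟩ := hmem.mp hp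
    exact hga v x
  · obtain ⟨v, rfl⟩ := hmem.mp hp
    exact ha v

theorem inH2_iff {g : Equiv.Perm CantorC} :
    InH2 g ↔ LexStrictMono g ∧ ∃ N, EvenAtDepth N g :=
  ⟨fun ⟨_, hJ, heven⟩ => ⟨hJ.lexStrictMono, hJ.exists_evenAtDepth heven⟩,
    fun ⟨hg, _, h⟩ => h.inH2 hg⟩

theorem EvenAtDepth.mul {M N : ℕ} {f g : Equiv.Perm CantorC} (hf : EvenAtDepth M f)
    (hg : EvenAtDepth N g) : EvenAtDepth (N + M) (f * g) := by
  intro w hw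
  obtain ⟨a, ha, hga⟩ := hg (w.take N) (by simp [hw])
  obtain ⟨b, hb, hfb⟩ := hf ((a ++ w.drop N).take M) (by simp [hw])
  refine ⟨b ++ (a ++ w.drop N).drop M, ?_, fun x => ?_⟩
  · simp only [List.length_append, List.length_take, List.length_drop] at ha hb ⊢
    omega
  · conv_lhs => rw [← List.take_append_drop N w]
    rw [Equiv.Perm.mul_apply, wordApp_append, hga, ← wordApp_append,
      ← List.take_append_drop M (a ++ w.drop N), wordApp_append, hfb, ← wordApp_append,
      List.take_append_drop]

theorem InH2.one : InH2 1 :=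
  inH2_iff.mpr ⟨fun _ _ h => h, 0, fun w _ => ⟨w, rfl, fun _ => rfl⟩⟩

theorem InH2.mul {f g : Equiv.Perm CantorC} (hf : InH2 f) (hg : InH2 g) : InH2 (f * g) := by
  obtain ⟨hf, M, hM⟩ := inH2_iff.mp hf
  obtain ⟨hg, N, hN⟩ := inH2_iff.mp hg
  exact inH2_iff.mpr ⟨fun x y h => hf _ _ (hg x y h), _, hM.mul hN⟩

theorem InducedBy.swap {J : Finset (BWord × BWord)} {g : Equiv.Perm CantorC}
    (h : InducedBy J g) : InducedBy (J.map (Equiv.prodComm _ _).toEmbedding) g⁻¹ := by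
  intro p hp x
  rw [Finset.mem_map_equiv] at hp
  rw [Equiv.Perm.inv_eq_iff_eq]
  exact (h _ hp x).symm

theorem InH2.inv {f : Equiv.Perm CantorC} (hf : InH2 f) : InH2 f⁻¹ := by
  obtain ⟨J, hJ, heven⟩ := hf
  refine ⟨J.map (Equiv.prodComm _ _).toEmbedding,
    IsCodeFor.of_lexStrictMono (fun x => ?_) hJ.2.2.swap fun x y h => ?_, fun p hp => ?_⟩
  · refine ((Equiv.prodComm BWord BWord).existsUnique_congr fun p => ?_).mp (hJ.1.1 x)
    simp
  · rw [← hJ.lexStrictMono.lt_iff_lt]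
    simpa using h
  · rw [Finset.mem_map_equiv] at hp
    exact (heven _ hp).symm

/-- `H₂` is a subgroup of Thompson's group `F`. -/
theorem stmt4 :
    (∀ g : Equiv.Perm CantorC, InH2 g → InF g) ∧
    InH2 (1 : Equiv.Perm CantorC) ∧
    (∀ f g : Equiv.Perm CantorC, InH2 f → InH2 g → InH2 (f * g)) ∧
    (∀ f : Equiv.Perm CantorC, InH2 f → InH2 f⁻¹) ∧
    ∃ H : Subgroup (Equiv.Perm CantorC), (H : Set (Equiv.Perm CantorC)) = {g | InH2 g} := by
  refine ⟨fun g ⟨J, hJ, _⟩ => ⟨J, hJ⟩, InH2.one, fun _ _ => InH2.mul, fun _ => InH2.inv, ?_⟩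
  exact ⟨{ carrier := {g | InH2 g}
           mul_mem' := InH2.mul
           one_mem' := InH2.one
           inv_mem' := InH2.inv }, rfl⟩
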